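/- arXiv:2304.08846 — 2 statements merged into one kernel-verified Lean document; each statement's English description precedes it below -/
import Mathlib

section
/- Let n, t, s and n₁, …, n_t be positive integers with n₁ ≥ n₂ ≥ ⋯ ≥ n_t ≥ 1 and n₁ + n₂ + ⋯ + n_t = n − s. Then λ₁(D(K_s ∨ (K_{n₁} ∪ K_{n₂} ∪ ⋯ ∪ K_{n_t}))) ≥ λ₁(D(K_s ∨ (K_{n-s-(t-1)} ∪ (t-1)K₁))), with equality if and only if K_s ∨ (K_{n₁} ∪ ⋯ ∪ K_{n_t}) is isomorphic to K_s ∨ (K_{n-s-(t-1)} ∪ (t-1)K₁). -/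
/-- The disjoint union `G ∪ H` of two simple graphs (on the sum of the vertex types). -/
def graphDisjUnion {α β : Type*} (G : SimpleGraph α) (H : SimpleGraph β) :
    SimpleGraph (α ⊕ β) :=
  SimpleGraph.fromRel (Sum.LiftRel G.Adj H.Adj)

/-- The join `G ∨ H` of two simple graphs: the disjoint union together with all edges
between the two parts. -/
def graphJoin {α β : Type*} (G : SimpleGraph α) (H : SimpleGraph β) :
    SimpleGraph (α ⊕ β) :=
  SimpleGraph.fromRel (fun u v => Sum.LiftRel G.Adj H.Adj u v ∨ (u.isLeft ∧ v.isRight))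

/-- The distance matrix of a graph: the `(u,v)` entry is the graph distance `d_G(u,v)`. -/
noncomputable def distMatrix {V : Type*} [Fintype V] (G : SimpleGraph V) :
    Matrix V V ℝ :=
  Matrix.of fun u v => (G.dist u v : ℝ)

/-- The distance spectral radius `λ₁(D(G))`: the largest eigenvalue of the distance
matrix of `G` (for a connected graph the distance matrix is symmetric nonnegative, so this
is the largest element of its real spectrum). -/
noncomputable def distSpecRad {V : Type*} [Fintype V] [DecidableEq V]
    (G : SimpleGraph V) : ℝ :=
  sSup (spectrum ℝ (distMatrix G))

/-- `G` has a spanning `k`-tree: a spanning subgraph which is a tree of maximum degree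
at most `k`. -/
def HasSpanningKTree {V : Type*} [Fintype V] (G : SimpleGraph V) (k : ℕ) : Prop :=
  ∃ T : SimpleGraph V, T ≤ G ∧ T.IsTree ∧ ∀ v : V, (T.neighborSet v).ncard ≤ k

/-- The Wiener index `W(G) = ∑_{i<j} d_G(v_i, v_j)`, written as half of the full double
sum of distances. -/
noncomputable def wiener {V : Type*} [Fintype V] (G : SimpleGraph V) : ℝ :=
  (∑ u : V, ∑ v : V, (G.dist u v : ℝ)) / 2

/-- The graph `G* = K₁ ∨ (K_{n-k-1} ∪ kK₁)`. -/
def starGraph (n k : ℕ) : SimpleGraph (Fin 1 ⊕ (Fin (n - k - 1) ⊕ Fin k)) :=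
  graphJoin (⊤ : SimpleGraph (Fin 1))
    (graphDisjUnion (⊤ : SimpleGraph (Fin (n - k - 1))) (⊥ : SimpleGraph (Fin k)))

/-- The graph `G♯ = K_{(n-3)/3} ∨ ((2n+3)/3)K₁`. -/
def sharpGraph (n : ℕ) : SimpleGraph (Fin ((n - 3) / 3) ⊕ Fin ((2 * n + 3) / 3)) :=
  graphJoin (⊤ : SimpleGraph (Fin ((n - 3) / 3))) (⊥ : SimpleGraph (Fin ((2 * n + 3) / 3)))

/-- The graph `G̃ = K_s ∨ (K_{n-(k-1)s-2} ∪ ((k-2)s+2)K₁)`. -/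
def tildeGraph (n k s : ℕ) :
    SimpleGraph (Fin s ⊕ (Fin (n - (k - 1) * s - 2) ⊕ Fin ((k - 2) * s + 2))) :=
  graphJoin (⊤ : SimpleGraph (Fin s))
    (graphDisjUnion (⊤ : SimpleGraph (Fin (n - (k - 1) * s - 2)))
      (⊥ : SimpleGraph (Fin ((k - 2) * s + 2))))

/-- The graph `G' = K_s ∨ (K_{n-s-(t-1)} ∪ (t-1)K₁)`. -/
def primeGraph (n s t : ℕ) :
    SimpleGraph (Fin s ⊕ (Fin (n - s - (t - 1)) ⊕ Fin (t - 1))) :=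
  graphJoin (⊤ : SimpleGraph (Fin s))
    (graphDisjUnion (⊤ : SimpleGraph (Fin (n - s - (t - 1)))) (⊥ : SimpleGraph (Fin (t - 1))))

/-- The disjoint union `K_{a 0} ∪ K_{a 1} ∪ ⋯ ∪ K_{a (t-1)}` of complete graphs. -/
def sigmaCompletes {t : ℕ} (a : Fin t → ℕ) : SimpleGraph (Σ i : Fin t, Fin (a i)) :=
  SimpleGraph.fromRel (fun u v => u.1 = v.1)

section RayleighQuotient

variable {V : Type*} [Fintype V] [DecidableEq V]

theorem Matrix.IsHermitian.posSemidef_sSup_spectrum_sub {A : Matrix V V ℝ} (hA : A.IsHermitian) :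
    (algebraMap ℝ (Matrix V V ℝ) (sSup (spectrum ℝ A)) - A).PosSemidef := by
  refine Matrix.posSemidef_iff_isHermitian_and_spectrum_nonneg.2 ⟨?_, ?_⟩
  · rw [Matrix.algebraMap_eq_diagonal]
    exact (Matrix.isHermitian_diagonal _).sub hA
  · rw [← spectrum.singleton_sub_eq]
    rintro _ ⟨_, rfl, x, hx, rfl⟩
    exact sub_nonneg.2 (le_csSup A.finite_real_spectrum.bddAbove hx)

/-- The Rayleigh bound for the supremum of the spectrum of a real symmetric matrix. -/
theorem Matrix.IsHermitian.dotProduct_mulVec_le {A : Matrix V V ℝ} (hA : A.IsHermitian)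
    (x : V → ℝ) : x ⬝ᵥ A.mulVec x ≤ sSup (spectrum ℝ A) * (x ⬝ᵥ x) := by
  have h := hA.posSemidef_sSup_spectrum_sub.dotProduct_mulVec_nonneg x
  simpa [Matrix.sub_mulVec, Algebra.algebraMap_eq_smul_one, Matrix.smul_mulVec,
    dotProduct_sub] using h

theorem Matrix.IsHermitian.mulVec_eq_of_dotProduct_le {A : Matrix V V ℝ} (hA : A.IsHermitian)
    {x : V → ℝ} (hx : sSup (spectrum ℝ A) * (x ⬝ᵥ x) ≤ x ⬝ᵥ A.mulVec x) :
    A.mulVec x = sSup (spectrum ℝ A) • x := by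
  have h := (hA.posSemidef_sSup_spectrum_sub.dotProduct_mulVec_zero_iff x).1 <| by
    simpa [Matrix.sub_mulVec, Algebra.algebraMap_eq_smul_one, Matrix.smul_mulVec,
      dotProduct_sub, sub_eq_zero] using le_antisymm hx (hA.dotProduct_mulVec_le x)
  simpa [Matrix.sub_mulVec, Algebra.algebraMap_eq_smul_one, Matrix.smul_mulVec,
    sub_eq_zero, eq_comm] using h

/-- A nonnegative symmetric matrix has a nonnegative eigenvector for its largest eigenvalue. -/
theorem Matrix.IsHermitian.exists_nonneg_eigenvector [Nonempty V] {A : Matrix V V ℝ}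
    (hA : A.IsHermitian) (hA0 : ∀ u v, 0 ≤ A u v) :
    ∃ y : V → ℝ, y ≠ 0 ∧ (∀ u, 0 ≤ y u) ∧ A.mulVec y = sSup (spectrum ℝ A) • y := by
  have hne : (spectrum ℝ A).Nonempty := by
    rw [hA.spectrum_real_eq_range_eigenvalues]
    exact Set.range_nonempty _
  have hmem := hne.csSup_mem A.finite_real_spectrum
  rw [← Matrix.spectrum_toLin', ← Module.End.hasEigenvalue_iff_mem_spectrum] at hmem
  obtain ⟨x, hx⟩ := hmem.exists_hasEigenvector
  have hxA : A.mulVec x = sSup (spectrum ℝ A) • x := by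
    simpa [Matrix.spectrum_toLin'] using hx.apply_eq_smul
  refine ⟨fun u ↦ |x u|, fun h ↦ hx.2 (funext fun u ↦ abs_eq_zero.1 (congrFun h u)),
    fun u ↦ abs_nonneg _, hA.mulVec_eq_of_dotProduct_le ?_⟩
  calc sSup (spectrum ℝ A) * ((fun u ↦ |x u|) ⬝ᵥ fun u ↦ |x u|)
      = x ⬝ᵥ A.mulVec x := by
        simp [hxA, dotProduct, Finset.mul_sum, mul_left_comm]
    _ ≤ _ := by
      simp only [dotProduct, Matrix.mulVec, Finset.mul_sum]
      refine Finset.sum_le_sum fun u _ ↦ Finset.sum_le_sum fun v _ ↦ (le_abs_self _).trans ?_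
      rw [abs_mul, abs_mul, abs_of_nonneg (hA0 u v)]

end RayleighQuotient

section DistanceMatrix

variable {V W : Type*} [Fintype V] [DecidableEq V] [Fintype W] [DecidableEq W]

theorem isHermitian_distMatrix {V : Type*} [Fintype V] (G : SimpleGraph V) :
    (distMatrix G).IsHermitian :=
  Matrix.IsHermitian.ext fun u v ↦ by simp [distMatrix, G.dist_comm]

theorem SimpleGraph.Iso.dist_le_dist {V W : Type*} {G : SimpleGraph V} {H : SimpleGraph W}
    (e : G ≃g H) {u v : V} (h : G.Reachable u v) : H.dist (e u) (e v) ≤ G.dist u v := by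
  obtain ⟨p, hp⟩ := h.exists_walk_length_eq_dist
  simpa [hp] using SimpleGraph.dist_le (p.map e.toHom)

theorem SimpleGraph.Iso.dist_apply {V W : Type*} {G : SimpleGraph V} {H : SimpleGraph W}
    (e : G ≃g H) (u v : V) : H.dist (e u) (e v) = G.dist u v := by
  by_cases h : G.Reachable u v
  · exact le_antisymm (e.dist_le_dist h) (by simpa using e.symm.dist_le_dist (e.reachable_iff.2 h))
  · rw [SimpleGraph.dist_eq_zero_of_not_reachable h,
      SimpleGraph.dist_eq_zero_of_not_reachable (mt e.reachable_iff.1 h)]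

theorem distSpecRad_congr {G : SimpleGraph V} {H : SimpleGraph W} (e : G ≃g H) :
    distSpecRad G = distSpecRad H := by
  have h : distMatrix G = Matrix.reindexAlgEquiv ℝ ℝ e.toEquiv.symm (distMatrix H) := by
    ext u v
    simp [distMatrix, ← e.dist_apply]
  rw [distSpecRad, h, AlgEquiv.spectrum_eq, distSpecRad]

open Classical in
theorem distMatrix_apply_of_forall_adj {G : SimpleGraph V} {c : V}
    (hc : ∀ v, v ≠ c → G.Adj c v) (u v : V) :
    distMatrix G u v = if u = v then 0 else if G.Adj u v then 1 else 2 := by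
  rw [distMatrix, Matrix.of_apply]
  split_ifs with huv hadj
  · simp [huv]
  · simp [SimpleGraph.dist_eq_one_iff_adj.2 hadj]
  · have hu : u ≠ c := fun h ↦ hadj (h ▸ hc v fun h' ↦ huv (h.trans h'.symm))
    have hv : v ≠ c := fun h ↦ hadj (h ▸ (hc u hu).symm)
    let p : G.Walk u v := .cons (hc u hu).symm (.cons (hc v hv) .nil)
    have h2 : G.dist u v ≤ 2 := G.dist_le p
    have h1 := p.reachable.one_lt_dist_of_ne_of_not_adj huv hadj
    exact_mod_cast le_antisymm h2 h1

/-- The distance matrix of a graph with a dominating vertex has a positive eigenvector for its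
largest eigenvalue. -/
theorem exists_pos_eigenvector_distMatrix {G : SimpleGraph V} {c : V}
    (hc : ∀ v, v ≠ c → G.Adj c v) :
    ∃ y : V → ℝ, 0 < distSpecRad G + 1 ∧ (∀ u, 0 < y u) ∧
      (∀ u, ∑ v, y v ≤ (distSpecRad G + 1) * y u) ∧
      ∀ u, ∑ v, distMatrix G u v * y v = distSpecRad G * y u := by
  classical
  have : Nonempty V := ⟨c⟩
  obtain ⟨y, hy0, hy, hDy⟩ := (isHermitian_distMatrix G).exists_nonneg_eigenvector
    fun u v ↦ by simp [distMatrix]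
  have heig (u : V) : ∑ v, distMatrix G u v * y v = distSpecRad G * y u := congrFun hDy u
  have hpos : 0 < ∑ v, y v := by
    obtain ⟨u, hu⟩ := Function.ne_iff.1 hy0
    exact Finset.sum_pos' (fun v _ ↦ hy v) ⟨u, Finset.mem_univ u, (hy u).lt_of_ne' hu⟩
  have hle (u : V) : ∑ v, y v ≤ (distSpecRad G + 1) * y u := by
    have : ∑ v, y v ≤ ∑ v, (distMatrix G u v * y v + if u = v then y v else 0) := by
      refine Finset.sum_le_sum fun v _ ↦ ?_
      rw [distMatrix_apply_of_forall_adj hc]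
      split_ifs <;> linarith [hy v]
    rw [Finset.sum_add_distrib, heig, Finset.sum_ite_eq] at this
    simpa [add_mul] using this
  have hyu (u : V) : 0 < y u := by
    refine (hy u).lt_of_ne' fun h ↦ ?_
    have := hle u
    rw [h, mul_zero] at this
    linarith
  exact ⟨y, pos_of_mul_pos_left (hpos.trans_le (hle c)) (hy c), hyu, hle, heig⟩

theorem distSpecRad_lt_of_sum_lt {G H : SimpleGraph V} {y : V → ℝ}
    (heig : ∀ u, ∑ v, distMatrix H u v * y v = distSpecRad H * y u)
    (hlt : 0 < ∑ u, ∑ v, (distMatrix G u v - distMatrix H u v) * (y u * y v)) :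
    distSpecRad H < distSpecRad G := by
  have h := (isHermitian_distMatrix G).dotProduct_mulVec_le y
  have hG : y ⬝ᵥ (distMatrix G).mulVec y = ∑ u, ∑ v, distMatrix G u v * (y u * y v) := by
    simp only [dotProduct, Matrix.mulVec, Finset.mul_sum]
    exact Finset.sum_congr rfl fun u _ ↦ Finset.sum_congr rfl fun v _ ↦ by ring
  have hH : distSpecRad H * (y ⬝ᵥ y) = ∑ u, ∑ v, distMatrix H u v * (y u * y v) := by
    simp only [dotProduct, Finset.mul_sum]
    refine Finset.sum_congr rfl fun u _ ↦ ?_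
    rw [mul_left_comm, ← heig, Finset.mul_sum]
    exact Finset.sum_congr rfl fun v _ ↦ by ring
  simp only [sub_mul, Finset.sum_sub_distrib] at hlt
  rw [← hG, ← hH] at hlt
  have hyy : 0 ≤ y ⬝ᵥ y := Finset.sum_nonneg fun u _ ↦ mul_self_nonneg _
  exact lt_of_mul_lt_mul_right ((sub_pos.1 hlt).trans_le h) hyy

end DistanceMatrix

section Join

variable {α β γ : Type*}

theorem graphJoin_adj_inl_inl {G : SimpleGraph α} {H : SimpleGraph β} {u v : α} :
    (graphJoin G H).Adj (.inl u) (.inl v) ↔ G.Adj u v := by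
  simp only [graphJoin, SimpleGraph.fromRel_adj]
  simpa [G.adj_comm v u] using fun h : G.Adj u v ↦ h.ne

theorem graphJoin_adj_inr_inr {G : SimpleGraph α} {H : SimpleGraph β} {u v : β} :
    (graphJoin G H).Adj (.inr u) (.inr v) ↔ H.Adj u v := by
  simp only [graphJoin, SimpleGraph.fromRel_adj]
  simpa [H.adj_comm v u] using fun h : H.Adj u v ↦ h.ne

theorem graphJoin_adj_inl_inr (G : SimpleGraph α) (H : SimpleGraph β) (u : α) (v : β) :
    (graphJoin G H).Adj (.inl u) (.inr v) := by
  simp [graphJoin, SimpleGraph.fromRel_adj]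

theorem graphJoin_top_adj_inl {H : SimpleGraph β} (u : α) (v : α ⊕ β) (h : v ≠ .inl u) :
    (graphJoin (⊤ : SimpleGraph α) H).Adj (.inl u) v := by
  cases v with
  | inl v => exact graphJoin_adj_inl_inl.2 fun h' ↦ h (congrArg _ h'.symm)
  | inr v => exact graphJoin_adj_inl_inr _ _ _ _

/-- An isomorphism of the right-hand graphs induces one of the joins. -/
def graphJoinCongrRight (G : SimpleGraph α) {H : SimpleGraph β} {K : SimpleGraph γ} (e : H ≃g K) :
    graphJoin G H ≃g graphJoin G K where
  toEquiv := Equiv.sumCongr (Equiv.refl α) e.toEquiv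
  map_rel_iff' {u v} := by
    rcases u with u | u <;> rcases v with v | v
    · exact graphJoin_adj_inl_inl.trans graphJoin_adj_inl_inl.symm
    · exact iff_of_true (graphJoin_adj_inl_inr _ _ _ _) (graphJoin_adj_inl_inr _ _ _ _)
    · exact iff_of_true (graphJoin_adj_inl_inr _ _ _ _).symm (graphJoin_adj_inl_inr _ _ _ _).symm
    · exact graphJoin_adj_inr_inr.trans (e.map_adj_iff.trans graphJoin_adj_inr_inr.symm)

/-- The graph consisting of a complete graph on the vertices satisfying `P`, all other vertices
being isolated. -/
def cliqueOn (P : α → Prop) : SimpleGraph α :=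
  SimpleGraph.fromRel fun u v ↦ P u ∧ P v

theorem cliqueOn_adj {P : α → Prop} {u v : α} : (cliqueOn P).Adj u v ↔ u ≠ v ∧ P u ∧ P v := by
  simp [cliqueOn, and_comm]

theorem nonempty_iso_cliqueOn [Fintype α] (P : α → Prop) [DecidablePred P] {m k : ℕ}
    (hm : Fintype.card {u // P u} = m) (hk : Fintype.card {u // ¬ P u} = k) :
    Nonempty (cliqueOn P ≃g
      graphDisjUnion (⊤ : SimpleGraph (Fin m)) (⊥ : SimpleGraph (Fin k))) := by
  let e : α ≃ Fin m ⊕ Fin k := (Equiv.sumCompl P).symm.trans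
    (Equiv.sumCongr (Fintype.equivFinOfCardEq hm) (Fintype.equivFinOfCardEq hk))
  refine ⟨⟨e, fun {u v} ↦ ?_⟩⟩
  obtain ⟨u, rfl⟩ := (Equiv.sumCompl P).surjective u
  obtain ⟨v, rfl⟩ := (Equiv.sumCompl P).surjective v
  rw [cliqueOn_adj]
  rcases u with u | u <;> rcases v with v | v <;>
    simp [e, graphDisjUnion, SimpleGraph.fromRel_adj, u.2, v.2, Subtype.ext_iff, eq_comm]

end Join

section SigmaCompletes

variable {t : ℕ} {a : Fin t → ℕ}

theorem sigmaCompletes_adj {u v : Σ i : Fin t, Fin (a i)} :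
    (sigmaCompletes a).Adj u v ↔ u ≠ v ∧ u.1 = v.1 := by
  simp [sigmaCompletes, eq_comm]

/-- All vertices of `K_{a 0} ∪ ⋯ ∪ K_{a (t-1)}` except the first vertex of each of the cliques
`K_{a 1}, …, K_{a (t-1)}`. -/
def IsBulk (u : Σ i : Fin t, Fin (a i)) : Prop := u.1.val = 0 ∨ u.2.val ≠ 0

instance : DecidablePred (IsBulk (a := a)) := fun u ↦
  inferInstanceAs (Decidable (u.1.val = 0 ∨ u.2.val ≠ 0))

theorem card_not_isBulk (ht : 0 < t) (ha : ∀ i, 1 ≤ a i) :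
    Fintype.card {u : Σ i : Fin t, Fin (a i) // ¬ IsBulk u} = t - 1 := by
  let e : {u : Σ i : Fin t, Fin (a i) // ¬ IsBulk u} ≃ {i : Fin t // i ≠ ⟨0, ht⟩} :=
    { toFun u := ⟨u.1.1, fun h ↦ u.2 (.inl (congrArg Fin.val h))⟩
      invFun i := ⟨⟨i, ⟨0, ha i⟩⟩, fun h ↦ h.elim (fun h ↦ i.2 (Fin.ext h)) fun h ↦ h rfl⟩
      left_inv := by
        rintro ⟨⟨i, j⟩, hu⟩
        have hj : (⟨0, ha i⟩ : Fin (a i)) = j := Fin.ext (not_not.1 (not_or.1 hu).2).symm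
        subst hj
        rfl
      right_inv _ := rfl }
  rw [Fintype.card_congr e, Fintype.card_subtype_compl, Fintype.card_subtype_eq, Fintype.card_fin]

theorem card_isBulk (ht : 0 < t) (ha : ∀ i, 1 ≤ a i) :
    Fintype.card {u : Σ i : Fin t, Fin (a i) // IsBulk u} = ∑ i, a i - (t - 1) := by
  have h := Fintype.card_subtype_compl (IsBulk (a := a))
  have hle := Fintype.card_subtype_le (IsBulk (a := a))
  rw [card_not_isBulk ht ha] at h
  simp only [Fintype.card_sigma, Fintype.card_fin] at h hle
  omega

theorem nonempty_iso_primeGraph {n s : ℕ} (ht : 0 < t) (ha : ∀ i, 1 ≤ a i)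
    (hsum : ∑ i, a i = n - s) :
    Nonempty (graphJoin (⊤ : SimpleGraph (Fin s)) (cliqueOn (IsBulk (a := a))) ≃g
      primeGraph n s t) :=
  (nonempty_iso_cliqueOn IsBulk (hsum ▸ card_isBulk ht ha) (card_not_isBulk ht ha)).map
    (graphJoinCongrRight _)

theorem sigmaCompletes_eq_cliqueOn (ha : ∀ i : Fin t, i.val ≠ 0 → a i = 1) :
    sigmaCompletes a = cliqueOn IsBulk := by
  have hbulk (u : Σ i : Fin t, Fin (a i)) : IsBulk u ↔ u.1.val = 0 := by
    refine or_iff_left_of_imp fun h ↦ by_contra fun h' ↦ ?_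
    have := ha u.1 h'
    have := u.2.isLt
    omega
  ext u v
  rw [sigmaCompletes_adj, cliqueOn_adj, hbulk, hbulk]
  refine and_congr_right fun huv ↦ ⟨fun h ↦ ?_, fun h ↦ Fin.ext (h.1.trans h.2.symm)⟩
  obtain ⟨i, j⟩ := u
  obtain ⟨i', j'⟩ := v
  obtain rfl : i = i' := h
  refine and_self_iff.2 (by_contra fun h' ↦ huv ?_)
  have := ha i h'
  have := j.isLt
  have := j'.isLt
  exact congrArg _ (Fin.ext (by omega))

open Classical in
/-- Passing from `cliqueOn IsBulk` to `sigmaCompletes a` decreases the adjacency quadratic form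
at vectors that are constant on and off the bulk, if their values satisfy `γ < 2 * β`. -/
theorem sum_adj_sub_adj_pos (ht : 0 < t) (ha : ∀ i, 1 ≤ a i) (h0 : 2 ≤ a ⟨0, ht⟩)
    {i : Fin t} (hi0 : i.val ≠ 0) (hi : 2 ≤ a i) {β γ : ℝ} (hβ : 0 < β) (hγ : γ < 2 * β)
    {z : (Σ i : Fin t, Fin (a i)) → ℝ} (hz : ∀ u, z u = if IsBulk u then β else γ) :
    0 < ∑ u, ∑ v, ((if (cliqueOn IsBulk).Adj u v then (1 : ℝ) else 0) -
      if (sigmaCompletes a).Adj u v then 1 else 0) * (z u * z v) := by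
  let q (u : Σ i : Fin t, Fin (a i)) : Prop := u.1.val ≠ 0 ∧ u.2.val ≠ 0
  let h (u v : Σ i : Fin t, Fin (a i)) : ℝ := if q u then
    (if v.1.val = 0 then β ^ 2 else 0) - (if v = ⟨u.1, ⟨0, ha u.1⟩⟩ then β * γ else 0) else 0
  have hrow (u : Σ i : Fin t, Fin (a i)) : ∑ v, h u v =
      if q u then a ⟨0, ht⟩ * β ^ 2 - β * γ else 0 := by
    by_cases hu : q u
    · simp only [h, if_pos hu, Finset.sum_sub_distrib, Finset.sum_ite_eq', Finset.mem_univ, if_true]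
      congr 1
      rw [Fintype.sum_sigma, Finset.sum_eq_single ⟨0, ht⟩]
      · simp
      · intro j _ hj
        have : j.val ≠ 0 := fun h ↦ hj (Fin.ext h)
        simp [this]
      · simp
    · simp [h, hu]
  have hpos : 0 < (a ⟨0, ht⟩ : ℝ) * β ^ 2 - β * γ := by
    have : (2 : ℝ) ≤ a ⟨0, ht⟩ := by exact_mod_cast h0
    nlinarith [mul_pos hβ (sub_pos.2 hγ), mul_nonneg (sub_nonneg.2 this) (sq_nonneg β)]
  have htotal : 0 < ∑ u, ∑ v, h u v := by
    simp only [hrow]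
    refine Finset.sum_pos' (fun u _ ↦ ?_) ⟨⟨i, ⟨1, hi⟩⟩, Finset.mem_univ _, ?_⟩
    · split_ifs <;> [exact hpos.le; exact le_rfl]
    · rwa [if_pos ⟨hi0, one_ne_zero⟩]
  have hswap : ∑ u, ∑ v, h v u = ∑ u, ∑ v, h u v := Finset.sum_comm
  calc (0 : ℝ) < ∑ u, ∑ v, (h u v + h v u) := by
        simp only [Finset.sum_add_distrib, hswap]
        linarith
    _ ≤ _ := by
      refine Finset.sum_le_sum fun u _ ↦ Finset.sum_le_sum fun v _ ↦ ?_
      rw [hz, hz]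
      simp only [h, q, cliqueOn_adj, sigmaCompletes_adj, IsBulk]
      obtain ⟨i, j⟩ := u
      obtain ⟨k, l⟩ := v
      by_cases hik : i = k
      · subst hik
        by_cases hi : i.val = 0 <;> by_cases hj : j.val = 0 <;> by_cases hl : l.val = 0 <;>
          simp [hi, hj, hl, Fin.ext_iff, eq_comm] <;> grind
      · have hne (j : Fin (a i)) (l : Fin (a k)) : (⟨i, j⟩ : Σ i : Fin t, Fin (a i)) ≠ ⟨k, l⟩ :=
          fun h ↦ hik (congrArg Sigma.fst h)
        have hne' (j : Fin (a i)) (l : Fin (a k)) : (⟨k, l⟩ : Σ i : Fin t, Fin (a i)) ≠ ⟨i, j⟩ :=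
          (hne j l).symm
        simp only [hne, hne', hik, ne_eq, not_false_eq_true, true_and, if_false, and_false]
        by_cases hi : i.val = 0 <;> by_cases hk : k.val = 0 <;> by_cases hj : j.val = 0 <;>
          by_cases hl : l.val = 0 <;>
          simp [hi, hj, hk, hl] <;> nlinarith [sq_nonneg β]

theorem distSpecRad_lt_of_two_le {s : ℕ} (hs : 0 < s) (ht : 0 < t) (ha : ∀ i, 1 ≤ a i)
    (h0 : 2 ≤ a ⟨0, ht⟩) {i : Fin t} (hi0 : i.val ≠ 0) (hi : 2 ≤ a i) :
    distSpecRad (graphJoin (⊤ : SimpleGraph (Fin s)) (cliqueOn (IsBulk (a := a)))) <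
      distSpecRad (graphJoin (⊤ : SimpleGraph (Fin s)) (sigmaCompletes a)) := by
  classical
  have hdist (H : SimpleGraph (Σ i : Fin t, Fin (a i))) :=
    distMatrix_apply_of_forall_adj (graphJoin_top_adj_inl (H := H) (⟨0, hs⟩ : Fin s))
  set H := graphJoin (⊤ : SimpleGraph (Fin s)) (cliqueOn (IsBulk (a := a))) with hH
  obtain ⟨y, hpos, hy, hle, heig⟩ := exists_pos_eigenvector_distMatrix
    (graphJoin_top_adj_inl (H := cliqueOn (IsBulk (a := a))) (⟨0, hs⟩ : Fin s))
  rw [← hH] at hpos hle heig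
  set r := distSpecRad H
  let L := ∑ u, y (.inl u)
  let M := ∑ u, if IsBulk u then y (.inr u) else 0
  let S := ∑ u, y (.inr u)
  have hL : 0 ≤ L := Finset.sum_nonneg fun u _ ↦ (hy _).le
  have hM : M ≤ S := Finset.sum_le_sum fun u _ ↦ by
    split_ifs
    exacts [le_rfl, (hy _).le]
  have hrow (u : Σ i : Fin t, Fin (a i)) :
      r * y (.inr u) = L + 2 * S - (if IsBulk u then M + y (.inr u) else 2 * y (.inr u)) := by
    rw [← heig, Fintype.sum_sum_type]
    have h1 (v : Fin s) : distMatrix H (.inr u) (.inl v) * y (.inl v) = y (.inl v) := by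
      rw [hdist, if_neg (by simp), if_pos (graphJoin_adj_inl_inr _ _ _ _).symm, one_mul]
    have h2 (v : Σ i : Fin t, Fin (a i)) : distMatrix H (.inr u) (.inr v) * y (.inr v) =
        2 * y (.inr v) - (if IsBulk u then
          (if IsBulk v then y (.inr v) else 0) + if u = v then y (.inr v) else 0
          else if u = v then 2 * y (.inr v) else 0) := by
      simp only [H, hdist, graphJoin_adj_inr_inr, cliqueOn_adj, Sum.inr.injEq]
      by_cases huv : u = v
      · subst huv
        by_cases hu : IsBulk u <;> simp [hu] <;> ring
      · by_cases hu : IsBulk u <;> by_cases hv : IsBulk v <;> simp [huv, hu, hv] <;> ring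
    simp only [h1, h2, Finset.sum_sub_distrib, ← Finset.mul_sum]
    by_cases hu : IsBulk u
    · simp only [if_pos hu, Finset.sum_add_distrib, Finset.sum_ite_eq, Finset.mem_univ, if_true]
      simp only [L, M, S]
      ring
    · simp only [if_neg hu, Finset.sum_ite_eq, Finset.mem_univ, if_true]
      simp only [L, S]
      ring
  let β := (L + 2 * S - M) / (r + 1)
  let γ := (L + 2 * S) / (r + 2)
  have hz (u : Σ i : Fin t, Fin (a i)) : y (.inr u) = if IsBulk u then β else γ := by
    have := hrow u
    split_ifs at this ⊢
    · rw [eq_div_iff hpos.ne']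
      linarith
    · rw [eq_div_iff (by linarith)]
      linarith
  have hβeq : (r + 1) * β = L + 2 * S - M := mul_div_cancel₀ _ hpos.ne'
  have hγeq : (r + 2) * γ = L + 2 * S := mul_div_cancel₀ _ (by linarith)
  have hβ : 0 < β := by
    have := hz ⟨⟨0, ht⟩, ⟨0, ha _⟩⟩
    rw [if_pos (.inl rfl)] at this
    exact this ▸ hy _
  have hMβ : M ≤ (r + 1) * β := by
    rw [hβeq]
    have := hle (.inr ⟨⟨0, ht⟩, ⟨0, ha _⟩⟩)
    rw [Fintype.sum_sum_type, hz, if_pos (.inl rfl), hβeq] at this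
    linarith
  have hγ : γ < 2 * β := by
    have : (r + 2) * γ < (r + 2) * (2 * β) := by linarith
    exact lt_of_mul_lt_mul_left this (by linarith)
  refine distSpecRad_lt_of_sum_lt heig ?_
  have hsub := sum_adj_sub_adj_pos ht ha h0 hi0 hi hβ hγ hz
  refine hsub.trans_eq ?_
  have hll (u : Fin s) (v : Fin s ⊕ Σ i : Fin t, Fin (a i)) :
      distMatrix (graphJoin (⊤ : SimpleGraph (Fin s)) (sigmaCompletes a)) (.inl u) v =
        distMatrix H (.inl u) v := by
    rw [hdist, hdist]
    cases v <;> simp [graphJoin_adj_inl_inl, graphJoin_adj_inl_inr]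
  have hlr (u : Σ i : Fin t, Fin (a i)) (v : Fin s) :
      distMatrix (graphJoin (⊤ : SimpleGraph (Fin s)) (sigmaCompletes a)) (.inr u) (.inl v) =
        distMatrix H (.inr u) (.inl v) := by
    rw [hdist, hdist, if_pos (graphJoin_adj_inl_inr _ _ _ _).symm,
      if_pos (graphJoin_adj_inl_inr _ _ _ _).symm]
  simp only [Fintype.sum_sum_type (α₁ := Fin s), hll, hlr, sub_self, zero_mul,
    Finset.sum_const_zero, zero_add]
  refine Finset.sum_congr rfl fun u _ ↦ Finset.sum_congr rfl fun v _ ↦ congrArg (· * _) ?_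
  rw [hdist, hdist, graphJoin_adj_inr_inr, graphJoin_adj_inr_inr]
  by_cases huv : u = v
  · simp [huv]
  · simp only [Sum.inr.injEq, if_neg huv]
    split_ifs <;> norm_num

end SigmaCompletes

/-- **Lemma (Statement 4).** For positive integers `n, t, s` and
`n₁ ≥ n₂ ≥ ⋯ ≥ n_t ≥ 1` with `n₁ + ⋯ + n_t = n - s`, we have
`λ₁(D(K_s ∨ (K_{n₁} ∪ ⋯ ∪ K_{n_t}))) ≥ λ₁(D(K_s ∨ (K_{n-s-(t-1)} ∪ (t-1)K₁)))`,
with equality iff the two graphs are isomorphic. -/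
theorem distSpecRad_sigmaCompletes_ge (n t s : ℕ) (hn : 0 < n) (ht : 0 < t) (hs : 0 < s)
    (hsn : s ≤ n) (a : Fin t → ℕ) (ha : ∀ i, 1 ≤ a i) (hmono : Antitone a)
    (hsum : ∑ i, a i = n - s) :
    distSpecRad (primeGraph n s t)
      ≤ distSpecRad (graphJoin (⊤ : SimpleGraph (Fin s)) (sigmaCompletes a)) ∧
    (distSpecRad (graphJoin (⊤ : SimpleGraph (Fin s)) (sigmaCompletes a))
        = distSpecRad (primeGraph n s t) ↔
      Nonempty ((graphJoin (⊤ : SimpleGraph (Fin s)) (sigmaCompletes a))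
        ≃g primeGraph n s t)) := by
  obtain ⟨e⟩ := nonempty_iso_primeGraph (n := n) (s := s) ht ha hsum
  rw [← distSpecRad_congr e]
  by_cases h : ∀ i : Fin t, i.val ≠ 0 → a i = 1
  · rw [sigmaCompletes_eq_cliqueOn h]
    exact ⟨le_rfl, iff_of_true rfl ⟨e⟩⟩
  · push Not at h
    obtain ⟨i, hi0, hi⟩ := h
    have hi2 : 2 ≤ a i := (ha i).lt_of_ne' hi
    have hlt := distSpecRad_lt_of_two_le hs ht ha (hi2.trans (hmono (Nat.zero_le _))) hi0 hi2
    exact ⟨hlt.le, iff_of_false hlt.ne' fun ⟨f⟩ ↦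
      hlt.ne' ((distSpecRad_congr f).trans (distSpecRad_congr e).symm)⟩
end

section
/- Let k ≥ 5 and s ≥ 1 be integers and let n = (k−1)s + 3. Then λ₁(D(K₁ ∨ (K_{n-k-1} ∪ kK₁))) ≤ λ₁(D(K_s ∨ (K_{n-(k-1)s-2} ∪ ((k−2)s+2)K₁))), with equality if and only if s = 1 (i.e., if and only if the two graphs are isomorphic). -/
open Finset Matrix in
/-- A Collatz–Wielandt bound: if a matrix `A` with nonnegative entries satisfies `A y ≤ c y` for
some positive vector `y`, then every real spectral value of `A` is at most `c`. -/
theorem spectrum_le_of_mulVec_le {V : Type*} [Fintype V] [DecidableEq V] {A : Matrix V V ℝ}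
    (hA : ∀ i j, 0 ≤ A i j) {y : V → ℝ} (hy : ∀ i, 0 < y i) {c : ℝ}
    (h : ∀ i, (A *ᵥ y) i ≤ c * y i) {μ : ℝ} (hμ : μ ∈ spectrum ℝ A) : μ ≤ c := by
  rw [← Matrix.spectrum_toLin'] at hμ
  obtain ⟨v, hv⟩ := (Module.End.hasEigenvalue_iff_mem_spectrum.mpr hμ).exists_hasEigenvector
  have hmul : A *ᵥ v = μ • v := by simpa using hv.apply_eq_smul
  obtain ⟨j, hj⟩ := Function.ne_iff.mp hv.2
  obtain ⟨i, -, hi⟩ := exists_max_image univ (fun i => |v i| / y i) ⟨j, mem_univ j⟩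
  set r := |v i| / y i with hr
  have hle : ∀ l, |v l| ≤ r * y l := fun l => (div_le_iff₀ (hy l)).mp (hi l (mem_univ l))
  have hvi : |v i| = r * y i := by rw [hr]; field_simp [(hy i).ne']
  have hr0 : 0 < r := lt_of_lt_of_le (div_pos (abs_pos.mpr hj) (hy j)) (hi j (mem_univ j))
  have hpos : 0 < |v i| := hvi ▸ mul_pos hr0 (hy i)
  have key : μ * |v i| ≤ c * |v i| :=
    calc μ * |v i| ≤ |μ * v i| := by
          rw [abs_mul]; exact mul_le_mul_of_nonneg_right (le_abs_self μ) (abs_nonneg _)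
      _ = |∑ l, A i l * v l| := by
          have := congrFun hmul i
          simp only [mulVec, dotProduct, Pi.smul_apply, smul_eq_mul] at this
          rw [this]
      _ ≤ ∑ l, |A i l * v l| := abs_sum_le_sum_abs _ _
      _ ≤ ∑ l, r * (A i l * y l) := by
          refine sum_le_sum fun l _ => ?_
          rw [abs_mul, abs_of_nonneg (hA i l)]
          nlinarith [mul_le_mul_of_nonneg_left (hle l) (hA i l)]
      _ = r * (A *ᵥ y) i := by rw [← mul_sum]; rfl
      _ ≤ r * (c * y i) := mul_le_mul_of_nonneg_left (h i) hr0.le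
      _ = c * |v i| := by rw [hvi]; ring
  exact le_of_mul_le_mul_right key hpos

theorem distMatrix_nonneg {V : Type*} [Fintype V] (G : SimpleGraph V) (u v : V) :
    0 ≤ distMatrix G u v := by
  simp [distMatrix]

open Matrix in
theorem distSpecRad_le_of_mulVec_le {V : Type*} [Fintype V] [DecidableEq V] (G : SimpleGraph V)
    {y : V → ℝ} (hy : ∀ i, 0 < y i) {c : ℝ} (hc : 0 ≤ c)
    (h : ∀ i, (distMatrix G *ᵥ y) i ≤ c * y i) : distSpecRad G ≤ c :=
  Real.sSup_le (fun _ hμ => spectrum_le_of_mulVec_le (distMatrix_nonneg G) hy h hμ) hc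

open Matrix in
theorem le_distSpecRad_of_mulVec_eq {V : Type*} [Fintype V] [DecidableEq V] (G : SimpleGraph V)
    {y : V → ℝ} (hy : y ≠ 0) {c : ℝ} (h : distMatrix G *ᵥ y = c • y) : c ≤ distSpecRad G := by
  refine le_csSup (Matrix.finite_real_spectrum (A := distMatrix G)).bddAbove ?_
  rw [← Matrix.spectrum_toLin']
  refine Module.End.hasEigenvalue_iff_mem_spectrum.mp
    (Module.End.hasEigenvalue_of_hasEigenvector (x := y) ⟨?_, hy⟩)
  exact Module.End.mem_eigenspace_iff.mpr (by simpa using h)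

/-- The graph `K_a ∨ (K_b ∪ cK₁)`. -/
def cliqueJoin (a b c : ℕ) : SimpleGraph (Fin a ⊕ (Fin b ⊕ Fin c)) :=
  graphJoin (⊤ : SimpleGraph (Fin a))
    (graphDisjUnion (⊤ : SimpleGraph (Fin b)) (⊥ : SimpleGraph (Fin c)))

theorem dist_eq_two_of_common_neighbor {V : Type*} {G : SimpleGraph V} {u v w : V} (hne : u ≠ v)
    (hadj : ¬ G.Adj u v) (huw : G.Adj u w) (hwv : G.Adj w v) : G.dist u v = 2 := by
  have hle : G.dist u v ≤ 2 := SimpleGraph.dist_le (.cons huw (.cons hwv .nil))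
  have hlt := SimpleGraph.Reachable.one_lt_dist_of_ne_of_not_adj
    (huw.reachable.trans hwv.reachable) hne hadj
  omega

section cliqueJoin

variable {a b c : ℕ}

theorem cliqueJoin_dist_left_left (i j : Fin a) :
    (cliqueJoin a b c).dist (.inl i) (.inl j) = if i = j then 0 else 1 := by
  split_ifs with h
  · simp [h]
  · rw [SimpleGraph.dist_eq_one_iff_adj]
    simp [cliqueJoin, graphJoin, h]

theorem cliqueJoin_adj_left_right (i : Fin a) (x : Fin b ⊕ Fin c) :
    (cliqueJoin a b c).Adj (.inl i) (.inr x) := by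
  simp [cliqueJoin, graphJoin]

theorem cliqueJoin_dist_left_right (i : Fin a) (x : Fin b ⊕ Fin c) :
    (cliqueJoin a b c).dist (.inl i) (.inr x) = 1 :=
  SimpleGraph.dist_eq_one_iff_adj.mpr (cliqueJoin_adj_left_right i x)

theorem cliqueJoin_dist_right_left (i : Fin a) (x : Fin b ⊕ Fin c) :
    (cliqueJoin a b c).dist (.inr x) (.inl i) = 1 :=
  SimpleGraph.dist_eq_one_iff_adj.mpr (cliqueJoin_adj_left_right i x).symm

theorem cliqueJoin_dist_clique (i j : Fin b) :
    (cliqueJoin a b c).dist (.inr (.inl i)) (.inr (.inl j)) = if i = j then 0 else 1 := by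
  split_ifs with h
  · simp [h]
  · rw [SimpleGraph.dist_eq_one_iff_adj]
    simp [cliqueJoin, graphJoin, graphDisjUnion, h]

theorem cliqueJoin_dist_of_not_adj (ha : 0 < a) {x y : Fin b ⊕ Fin c} (hne : x ≠ y)
    (h : ¬ (cliqueJoin a b c).Adj (.inr x) (.inr y)) :
    (cliqueJoin a b c).dist (.inr x) (.inr y) = 2 :=
  dist_eq_two_of_common_neighbor (w := .inl ⟨0, ha⟩) (by simpa using hne) h
    (cliqueJoin_adj_left_right _ _).symm (cliqueJoin_adj_left_right _ _)

theorem cliqueJoin_dist_clique_indep (ha : 0 < a) (i : Fin b) (j : Fin c) :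
    (cliqueJoin a b c).dist (.inr (.inl i)) (.inr (.inr j)) = 2 :=
  cliqueJoin_dist_of_not_adj ha (by simp) (by simp [cliqueJoin, graphJoin, graphDisjUnion])

theorem cliqueJoin_dist_indep_clique (ha : 0 < a) (i : Fin b) (j : Fin c) :
    (cliqueJoin a b c).dist (.inr (.inr j)) (.inr (.inl i)) = 2 :=
  cliqueJoin_dist_of_not_adj ha (by simp) (by simp [cliqueJoin, graphJoin, graphDisjUnion])

theorem cliqueJoin_dist_indep (ha : 0 < a) (i j : Fin c) :
    (cliqueJoin a b c).dist (.inr (.inr i)) (.inr (.inr j)) = if i = j then 0 else 2 := by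
  split_ifs with h
  · simp [h]
  · exact cliqueJoin_dist_of_not_adj ha (by simpa using h)
      (by simp [cliqueJoin, graphJoin, graphDisjUnion])

theorem sum_ite_eq_zero_else (m : ℕ) (i : Fin m) (w : ℝ) :
    ∑ j : Fin m, (if i = j then 0 else w) = (m - 1) * w := by
  have h : ∀ j : Fin m, (if i = j then 0 else w) = w - if i = j then w else 0 := by
    intro j; split_ifs <;> simp
  simp only [h, Finset.sum_sub_distrib]
  simp
  ring

/-- The vector taking the values `p`, `q`, `r` on the three blocks of `K_a ∨ (K_b ∪ cK₁)`. -/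
def blockVec (a b c : ℕ) (p q r : ℝ) : Fin a ⊕ (Fin b ⊕ Fin c) → ℝ :=
  Sum.elim (fun _ => p) (Sum.elim (fun _ => q) (fun _ => r))

open Matrix in
/-- The distance matrix of `K_a ∨ (K_b ∪ cK₁)` acts on block vectors by its quotient matrix. -/
theorem cliqueJoin_distMatrix_mulVec_blockVec (ha : 0 < a) (p q r : ℝ) :
    distMatrix (cliqueJoin a b c) *ᵥ blockVec a b c p q r =
      blockVec a b c ((a - 1) * p + b * q + c * r) (a * p + (b - 1) * q + 2 * c * r)
        (a * p + 2 * b * q + 2 * (c - 1) * r) := by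
  funext x
  rcases x with i | i | i <;>
    simp only [mulVec, dotProduct, distMatrix, blockVec, of_apply, Fintype.sum_sum_type,
      Sum.elim_inl, Sum.elim_inr, cliqueJoin_dist_left_left, cliqueJoin_dist_left_right,
      cliqueJoin_dist_right_left, cliqueJoin_dist_clique, cliqueJoin_dist_clique_indep ha,
      cliqueJoin_dist_indep_clique ha, cliqueJoin_dist_indep ha, Nat.cast_ite, Nat.cast_zero,
      Nat.cast_one, Nat.cast_ofNat, ← Finset.sum_mul, sum_ite_eq_zero_else] <;>
    simp <;> ring

end cliqueJoin

/-- An upper bound for `λ₁(D(K₁ ∨ (K_m ∪ kK₁)))` from a nonnegative value of minus the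
characteristic polynomial of the quotient matrix. -/
theorem distSpecRad_cliqueJoin_one_le {m k : ℕ} {x : ℝ} (hx : 0 < x)
    (h : 0 ≤ x * ((x + 1) * (x + 2)) - m * ((x + 1) * (x + 2) + k * (2 * x + 1))
      - k * ((2 * x + 1) * (x + 1))) :
    distSpecRad (cliqueJoin 1 m k) ≤ x := by
  have hk : (0 : ℝ) ≤ k := k.cast_nonneg
  refine distSpecRad_le_of_mulVec_le _ (y := blockVec 1 m k ((x + 1) * (x + 2))
    ((x + 1) * (x + 2) + k * (2 * x + 1)) ((2 * x + 1) * (x + 1))) ?_ hx.le ?_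
  · rintro (i | i | i) <;> simp only [blockVec, Sum.elim_inl, Sum.elim_inr] <;> positivity
  · intro i
    rw [cliqueJoin_distMatrix_mulVec_blockVec one_pos]
    rcases i with i | i | i <;> simp only [blockVec, Sum.elim_inl, Sum.elim_inr, Nat.cast_one] <;>
      linarith

/-- A lower bound for `λ₁(D(K_s ∨ (c + 1)K₁))` from a negative value of the characteristic
polynomial of the quotient matrix. -/
theorem lt_distSpecRad_cliqueJoin {s c : ℕ} (hs : 0 < s) {x : ℝ} (hx : x ≤ 2 * c + s)
    (h : (x - (s - 1)) * (x - 2 * c) - s * (c + 1) < 0) :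
    x < distSpecRad (cliqueJoin s 1 c) := by
  have hs' : (0 : ℝ) < s := by exact_mod_cast hs
  have hc : (0 : ℝ) ≤ c := c.cast_nonneg
  obtain ⟨l, hl, hl0⟩ : (0 : ℝ) ∈ Set.image
      (fun y : ℝ => (y - (s - 1)) * (y - 2 * c) - s * (c + 1)) (Set.Icc x (2 * c + s)) := by
    refine intermediate_value_Icc hx (by fun_prop) ⟨h.le, ?_⟩
    nlinarith [mul_nonneg hs'.le hc]
  simp only at hl0
  have hxl : x < l := by
    refine lt_of_le_of_ne hl.1 ?_
    rintro rfl
    exact h.ne hl0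
  refine hxl.trans_le (le_distSpecRad_of_mulVec_eq _ (y := blockVec s 1 c (l - 2 * c) s s) ?_ ?_)
  · intro h0
    have := congrFun h0 (.inr (.inl 0))
    simp only [blockVec, Sum.elim_inl, Sum.elim_inr, Pi.zero_apply] at this
    exact hs'.ne' this
  · rw [cliqueJoin_distMatrix_mulVec_blockVec hs]
    funext i
    rcases i with i | i | i <;>
      simp only [blockVec, Sum.elim_inl, Sum.elim_inr, Nat.cast_one, Pi.smul_apply,
        smul_eq_mul] <;>
      linarith

theorem distSpecRad_star_lt_tilde_boundary (u v : ℕ) :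
    distSpecRad (cliqueJoin 1 ((u + 4) * (v + 1) + 1) (u + 5)) <
      distSpecRad (cliqueJoin (v + 2) 1 ((u + 3) * (v + 2) + 2)) := by
  have hu : (0 : ℝ) ≤ u := u.cast_nonneg
  have hv : (0 : ℝ) ≤ v := v.cast_nonneg
  have hx : (0 : ℝ) < 2 * ((u + 3) * (v + 2) + 2) + (v + 2) / 2 := by positivity
  refine (distSpecRad_cliqueJoin_one_le hx ?_).trans_lt
    (lt_distSpecRad_cliqueJoin (by omega) ?_ ?_)
  · push_cast
    ring_nf
    positivity
  · push_cast
    linarith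
  · push_cast
    nlinarith [mul_nonneg hu hv, mul_nonneg hv hv]

/-- **Claim 3 (Statement 9).** Let `k ≥ 5`, `s ≥ 1` and `n = (k-1)s + 3`. Then
`λ₁(D(K₁ ∨ (K_{n-k-1} ∪ kK₁))) ≤ λ₁(D(K_s ∨ (K_{n-(k-1)s-2} ∪ ((k-2)s+2)K₁)))`,
with equality iff `s = 1`. -/
theorem distSpecRad_star_le_tilde_boundary (k s n : ℕ) (hk : 5 ≤ k) (hs : 1 ≤ s)
    (hn : n = (k - 1) * s + 3) :
    distSpecRad (starGraph n k) ≤ distSpecRad (tildeGraph n k s) ∧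
    (distSpecRad (starGraph n k) = distSpecRad (tildeGraph n k s) ↔ s = 1) := by
  obtain ⟨u, rfl⟩ := Nat.exists_eq_add_of_le' hk
  have hstar : distSpecRad (starGraph n (u + 5)) =
      distSpecRad (cliqueJoin 1 (n - (u + 5) - 1) (u + 5)) := rfl
  have htilde : distSpecRad (tildeGraph n (u + 5) s) =
      distSpecRad (cliqueJoin s (n - (u + 5 - 1) * s - 2) ((u + 5 - 2) * s + 2)) := rfl
  rw [hstar, htilde]
  have hone : n - (u + 5 - 1) * s - 2 = 1 := by omega
  have hu4 : u + 5 - 1 = u + 4 := by omega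
  have hu3 : u + 5 - 2 = u + 3 := by omega
  rw [hone, hu3]
  rw [hu4] at hn
  rcases hs.eq_or_lt with rfl | hs2
  · have hm : n - (u + 5) - 1 = 1 := by omega
    have hc : (u + 3) * 1 + 2 = u + 5 := by omega
    rw [hm, hc]
    simp
  · obtain ⟨v, rfl⟩ : ∃ v, s = v + 2 := Nat.exists_eq_add_of_le' hs2
    have hm : n - (u + 5) - 1 = (u + 4) * (v + 1) + 1 := by
      have : (u + 4) * (v + 2) = (u + 4) * (v + 1) + (u + 4) := by ring
      omega
    have hlt := distSpecRad_star_lt_tilde_boundary u v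
    rw [hm]
    exact ⟨hlt.le, fun h => absurd h hlt.ne, fun h => absurd h (by omega)⟩
end
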